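/- For every weighted concurrent game structure G whose weight function takes values in a finite set V ⊆ [0,1] with {0,1} ⊆ V, and every SL[F] state formula φ, the set of satisfaction values {⟦φ⟧^G_χ(ρ) : χ an assignment, ρ a history of G} is finite. -/

import Mathlib

open scoped Classical

/-- A weighted concurrent game structure over agents `Agt`, atomic propositions `AP`,
actions `Act` and positions `Pos`. -/
structure WCGS (Agt AP Act Pos : Type) where
  init : Pos
  tr : Pos → (Agt → Act) → Pos
  wt : AP → Pos → ℝ

variable {Agt AP Act Pos Var : Type}

/-- Histories, represented as reversed nonempty lists of positions
(the head of the list is the last position of the history). -/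
inductive IsHist (G : WCGS Agt AP Act Pos) : List Pos → Prop
  | base : IsHist G [G.init]
  | step {ρ : List Pos} {pos : Pos} (h : IsHist G (pos :: ρ)) (c : Agt → Act) :
      IsHist G (G.tr pos c :: pos :: ρ)

/-- A strategy maps (reversed) histories to actions. -/
abbrev Strategy (Act Pos : Type) := List Pos → Act

/-- An assignment is a partial map from agents and variables to strategies. -/
abbrev Assignment (Agt Var Act Pos : Type) := Agt ⊕ Var → Option (Strategy Act Pos)

/-- The (reversed) prefix `π_0 … π_i` of a play. -/
def pref (π : ℕ → Pos) (i : ℕ) : List Pos := ((List.range (i + 1)).map π).reverse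

/-- The play `π` extends the history `ρ`, is a play of `G`, and is `χ`-consistent
from `ρ` on. -/
def Consistent (G : WCGS Agt AP Act Pos) (χ : Assignment Agt Var Act Pos)
    (ρ : List Pos) (π : ℕ → Pos) : Prop :=
  π 0 = G.init ∧ pref π (ρ.length - 1) = ρ ∧
    ∀ i, ∃ c : Agt → Act, π (i + 1) = G.tr (π i) c ∧
      (ρ.length - 1 ≤ i → ∀ a σ, χ (Sum.inl a) = some σ → c a = σ (pref π i))

mutual
/-- SL[F] state formulas. -/
inductive SLs (AP Var Agt : Type) : Type where
  | atom : AP → SLs AP Var Agt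
  | app : (n : ℕ) → ((Fin n → ℝ) → ℝ) → (Fin n → SLs AP Var Agt) → SLs AP Var Agt
  | exS : Var → SLs AP Var Agt → SLs AP Var Agt
  | bind : Agt → Var → SLs AP Var Agt → SLs AP Var Agt
  | All : SLp AP Var Agt → SLs AP Var Agt
/-- SL[F] path formulas. -/
inductive SLp (AP Var Agt : Type) : Type where
  | state : SLs AP Var Agt → SLp AP Var Agt
  | next : SLp AP Var Agt → SLp AP Var Agt
  | until_ : SLp AP Var Agt → SLp AP Var Agt → SLp AP Var Agt
  | app : (n : ℕ) → ((Fin n → ℝ) → ℝ) → (Fin n → SLp AP Var Agt) → SLp AP Var Agt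
end

mutual
/-- Satisfaction value of an SL[F] state formula on a history (reversed list). -/
noncomputable def ssemSL (G : WCGS Agt AP Act Pos) :
    SLs AP Var Agt → Assignment Agt Var Act Pos → List Pos → ℝ
  | .atom p, _, ρ => G.wt p (ρ.headD G.init)
  | .app n f args, χ, ρ => f fun i => ssemSL G (args i) χ ρ
  | .exS x φ, χ, ρ =>
      sSup {v | ∃ σ : Strategy Act Pos,
        ssemSL G φ (fun y => if y = Sum.inr x then some σ else χ y) ρ = v}
  | .bind a x φ, χ, ρ =>
      ssemSL G φ (fun y => if y = Sum.inl a then χ (Sum.inr x) else χ y) ρ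
  | .All ψ, χ, ρ =>
      sInf {v | ∃ π : ℕ → Pos, Consistent G χ ρ π ∧
        psemSL G ψ χ π (ρ.length - 1) = v}
/-- Satisfaction value of an SL[F] path formula on a play at an index. -/
noncomputable def psemSL (G : WCGS Agt AP Act Pos) :
    SLp AP Var Agt → Assignment Agt Var Act Pos → (ℕ → Pos) → ℕ → ℝ
  | .state φ, χ, π, i => ssemSL G φ χ (pref π i)
  | .next ψ, χ, π, i => psemSL G ψ χ π (i + 1)
  | .until_ ψ₁ ψ₂, χ, π, i =>
      sSup {v | ∃ k, i ≤ k ∧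
        v = min (psemSL G ψ₂ χ π k)
          (sInf ({w | ∃ j, i ≤ j ∧ j < k ∧ psemSL G ψ₁ χ π j = w} ∪ {1}))}
  | .app n f args, χ, π, i => f fun j => psemSL G (args j) χ π i
end

theorem sSup_mem_insert_zero {A T : Set ℝ} (hT : T.Finite) (hA : A ⊆ T) :
    sSup A ∈ insert 0 T := by
  rcases A.eq_empty_or_nonempty with rfl | hne
  · simp
  · exact Or.inr (hA (hne.csSup_mem (hT.subset hA)))

theorem sInf_mem_insert_zero {A T : Set ℝ} (hT : T.Finite) (hA : A ⊆ T) :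
    sInf A ∈ insert 0 T := by
  rcases A.eq_empty_or_nonempty with rfl | hne
  · simp
  · exact Or.inr (hA (hne.csInf_mem (hT.subset hA)))

mutual
/-- A state formula takes its values in a finite set, whatever the assignment and the list of
positions it is evaluated on. -/
theorem exists_finite_ssemSL (G : WCGS Agt AP Act Pos) {V : Set ℝ} (hV : V.Finite)
    (hwt : ∀ p pos, G.wt p pos ∈ V) : ∀ φ : SLs AP Var Agt,
    ∃ S : Set ℝ, S.Finite ∧
      ∀ (χ : Assignment Agt Var Act Pos) (ρ : List Pos), ssemSL G φ χ ρ ∈ S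
  | .atom p => ⟨V, hV, fun χ ρ => by rw [ssemSL]; exact hwt _ _⟩
  | .app _ f args => by
    choose S hS hmem using fun i => exists_finite_ssemSL G hV hwt (args i)
    refine ⟨f '' Set.univ.pi S, (Set.Finite.pi hS).image f, fun χ ρ => ?_⟩
    rw [ssemSL]
    exact ⟨_, fun i _ => hmem i χ ρ, rfl⟩
  | .exS x φ => by
    obtain ⟨S, hS, hmem⟩ := exists_finite_ssemSL G hV hwt φ
    refine ⟨insert 0 S, hS.insert 0, fun χ ρ => ?_⟩
    rw [ssemSL]
    refine sSup_mem_insert_zero hS ?_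
    rintro _ ⟨σ, rfl⟩
    exact hmem _ _
  | .bind a x φ => by
    obtain ⟨S, hS, hmem⟩ := exists_finite_ssemSL G hV hwt φ
    refine ⟨S, hS, fun χ ρ => ?_⟩
    rw [ssemSL]
    exact hmem _ _
  | .All ψ => by
    obtain ⟨S, hS, hmem⟩ := exists_finite_psemSL G hV hwt ψ
    refine ⟨insert 0 S, hS.insert 0, fun χ ρ => ?_⟩
    rw [ssemSL]
    refine sInf_mem_insert_zero hS ?_
    rintro _ ⟨π, _, rfl⟩
    exact hmem _ _ _
/-- A path formula takes its values in a finite set, whatever the assignment, the sequence of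
positions and the index it is evaluated at. -/
theorem exists_finite_psemSL (G : WCGS Agt AP Act Pos) {V : Set ℝ} (hV : V.Finite)
    (hwt : ∀ p pos, G.wt p pos ∈ V) : ∀ ψ : SLp AP Var Agt,
    ∃ S : Set ℝ, S.Finite ∧
      ∀ (χ : Assignment Agt Var Act Pos) (π : ℕ → Pos) (i : ℕ), psemSL G ψ χ π i ∈ S
  | .state φ => by
    obtain ⟨S, hS, hmem⟩ := exists_finite_ssemSL G hV hwt φ
    refine ⟨S, hS, fun χ π i => ?_⟩
    rw [psemSL]
    exact hmem _ _
  | .next ψ => by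
    obtain ⟨S, hS, hmem⟩ := exists_finite_psemSL G hV hwt ψ
    refine ⟨S, hS, fun χ π i => ?_⟩
    rw [psemSL]
    exact hmem _ _ _
  | .until_ ψ₁ ψ₂ => by
    obtain ⟨S₁, hS₁, hmem₁⟩ := exists_finite_psemSL G hV hwt ψ₁
    obtain ⟨S₂, hS₂, hmem₂⟩ := exists_finite_psemSL G hV hwt ψ₂
    have hS₁' : (S₁ ∪ {1}).Finite := hS₁.union (Set.finite_singleton 1)
    have hT : (S₂ ∪ insert 0 (S₁ ∪ {1})).Finite := hS₂.union (hS₁'.insert 0)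
    refine ⟨_, hT.insert 0, fun χ π i => ?_⟩
    rw [psemSL]
    refine sSup_mem_insert_zero hT ?_
    rintro _ ⟨k, _, rfl⟩
    rcases min_choice (psemSL G ψ₂ χ π k)
      (sInf ({w | ∃ j, i ≤ j ∧ j < k ∧ psemSL G ψ₁ χ π j = w} ∪ {1})) with h | h <;> rw [h]
    · exact Or.inl (hmem₂ _ _ _)
    · refine Or.inr (sInf_mem_insert_zero hS₁' (Set.union_subset_union_left _ ?_))
      rintro _ ⟨j, _, _, rfl⟩
      exact hmem₁ _ _ _
  | .app _ f args => by
    choose S hS hmem using fun i => exists_finite_psemSL G hV hwt (args i)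
    refine ⟨f '' Set.univ.pi S, (Set.Finite.pi hS).image f, fun χ π i => ?_⟩
    rw [psemSL]
    exact ⟨_, fun j _ => hmem j χ π i, rfl⟩
end

/-- If the weight function of a WCGS takes values in a finite set
`V ⊆ [0,1]` containing `0` and `1`, then every SL[F] state formula takes only
finitely many satisfaction values (over all assignments and histories). -/
theorem stmt8 {Agt AP Act Pos Var : Type}
    [Fintype Agt] [Fintype AP] [Fintype Act] [Fintype Pos] [Fintype Var]
    [Nonempty Act]
    (G : WCGS Agt AP Act Pos)
    (V : Set ℝ) (hVfin : V.Finite) (hVsub : V ⊆ Set.Icc (0 : ℝ) 1)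
    (h0 : (0 : ℝ) ∈ V) (h1 : (1 : ℝ) ∈ V)
    (hwt : ∀ p pos, G.wt p pos ∈ V)
    (φ : SLs AP Var Agt) :
    {v : ℝ | ∃ (χ : Assignment Agt Var Act Pos) (ρ : List Pos),
      IsHist G ρ ∧ ssemSL G φ χ ρ = v}.Finite := by
  exact (exists_finite_ssemSL G hVfin hwt φ).elim fun S hS =>
    hS.1.subset fun _ ⟨χ, ρ, _, h⟩ => h ▸ hS.2 χ ρ
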